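/- arXiv:math/0608673 — 5 statements merged into one kernel-verified Lean document; each statement's English description precedes it below -/
import Mathlib

section
/- For every k ≥ 0 and every linear map D : H → H^{⊗(k+1)}, one has the identity (D⊗id_H + id_H⊗D)(ω₀) = D* − σ_{k+2}(D*) in H^{⊗(k+2)}; consequently D(ω₀) = 0 if and only if σ_{k+2}(D*) = D*. -/
/- Coordinate model of the symplectic vector space `H = ℚ^{2g}` and its tensor powers.
`I g` indexes the symplectic basis `x_1, …, x_g, y_1, …, y_g`;
`T g m` is the coordinate model of `H^{⊗ m}` (coordinates w.r.t. the basis tensors). -/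

abbrev I (g : ℕ) := Fin g ⊕ Fin g
abbrev H (g : ℕ) := I g → ℚ
abbrev T (g m : ℕ) := (Fin m → I g) → ℚ

/-- the basis vector `x_i` -/
def xB (g : ℕ) (i : Fin g) : H g := Pi.single (Sum.inl i) 1
/-- the basis vector `y_i` -/
def yB (g : ℕ) (i : Fin g) : H g := Pi.single (Sum.inr i) 1

/-- the symplectic intersection pairing `u · v` -/
def pairH (g : ℕ) (u v : H g) : ℚ :=
  ∑ i : Fin g, (u (Sum.inl i) * v (Sum.inr i) - u (Sum.inr i) * v (Sum.inl i))

/-- `D(ω₀) = (D ⊗ id + id ⊗ D)(ω₀)` for `ω₀ = Σᵢ (xᵢ ⊗ yᵢ - yᵢ ⊗ xᵢ)`. -/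
def Dom (g k : ℕ) (D : H g →ₗ[ℚ] T g (k+1)) : T g (k+2) := fun φ =>
  ∑ i : Fin g,
    (D (xB g i) (fun p => φ p.castSucc) * yB g i (φ (Fin.last (k+1)))
      + xB g i (φ 0) * D (yB g i) (fun p => φ p.succ)
      - D (yB g i) (fun p => φ p.castSucc) * xB g i (φ (Fin.last (k+1)))
      - yB g i (φ 0) * D (xB g i) (fun p => φ p.succ))

/-- `D* = Σᵢ (xᵢ ⊗ D(yᵢ) - yᵢ ⊗ D(xᵢ))`. -/
def dstar (g k : ℕ) (D : H g →ₗ[ℚ] T g (k+1)) : T g (k+2) := fun φ =>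
  ∑ i : Fin g,
    (xB g i (φ 0) * D (yB g i) (fun p => φ p.succ)
      - yB g i (φ 0) * D (xB g i) (fun p => φ p.succ))

/-- the cyclic permutation `σ_m : u₁ ⊗ ⋯ ⊗ u_m ↦ u₂ ⊗ ⋯ ⊗ u_m ⊗ u₁`. -/
def cyc (g m : ℕ) (t : T g m) : T g m := fun φ => t (φ ∘ (finRotate m).symm)

theorem finRotate_symm_zero (n : ℕ) : (finRotate (n + 1)).symm 0 = Fin.last n := by
  rw [Equiv.symm_apply_eq, finRotate_last]

theorem finRotate_symm_succ {n : ℕ} (p : Fin n) :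
    (finRotate (n + 1)).symm p.succ = p.castSucc := by
  rw [Equiv.symm_apply_eq, finRotate_apply, Fin.coeSucc_eq_succ]

/-- for every `k ≥ 0` and every linear `D : H → H^{⊗(k+1)}` one has
`(D⊗id + id⊗D)(ω₀) = D* - σ_{k+2}(D*)`, and consequently `D(ω₀) = 0` iff
`σ_{k+2}(D*) = D*`. -/
theorem stmt0 (g : ℕ) (hg : 1 ≤ g) (k : ℕ) (D : H g →ₗ[ℚ] T g (k+1)) :
    Dom g k D = dstar g k D - cyc g (k+2) (dstar g k D) ∧
    (Dom g k D = 0 ↔ cyc g (k+2) (dstar g k D) = dstar g k D) := by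
  have h : Dom g k D = dstar g k D - cyc g (k+2) (dstar g k D) := by
    funext φ
    simp only [Dom, dstar, cyc, Pi.sub_apply, Function.comp_apply, finRotate_symm_zero,
      finRotate_symm_succ, ← Finset.sum_sub_distrib]
    exact Finset.sum_congr rfl fun i _ => by ring
  exact ⟨h, by rw [h, sub_eq_zero, eq_comm]⟩
end

section
/- For every k ≥ 1, the map D ↦ Σ_{i=1}^g (x_i⊗D(y_i) − y_i⊗D(x_i)) is a linear isomorphism from 𝔩_g(k) = {D ∈ Hom(H, L(k+1)) : D̃(ω₀^L) = 0} onto the kernel of the bracket map H ⊗ L(k+1) → L(k+2), u⊗ξ ↦ [ι(u), ξ]. -/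
set_option maxSynthPendingDepth 2

open scoped TensorProduct

/-- the free Lie algebra over `ℚ` generated by the vector space `H` -/
abbrev L (g : ℕ) := FreeLieAlgebra ℚ (I g)

/-- the canonical (linear) embedding `ι : H → L` -/
noncomputable def iotaL (g : ℕ) : H g →ₗ[ℚ] L g where
  toFun u := ∑ j : I g, u j • FreeLieAlgebra.of ℚ j
  map_add' u v := by
    simp only [Pi.add_apply, add_smul]
    exact Finset.sum_add_distrib
  map_smul' a u := by
    simp only [Pi.smul_apply, smul_eq_mul, RingHom.id_apply, mul_smul]
    rw [Finset.smul_sum]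

/-- the degree `m` homogeneous component `L(m)` of the free Lie algebra:
`L(1) = ι(H)` and `L(m+1) = span{[ι(u), ξ] : u ∈ H, ξ ∈ L(m)}`. -/
noncomputable def LS (g : ℕ) : ℕ → Submodule ℚ (L g)
  | 0 => ⊥
  | 1 => LinearMap.range (iotaL g)
  | (m+2) => Submodule.span ℚ {z : L g | ∃ u : H g, ∃ ξ ∈ LS g (m+1), z = ⁅iotaL g u, ξ⁆}

/-- the symplectic class `ω₀ = Σᵢ [ι(xᵢ), ι(yᵢ)] ∈ L(2)` -/
noncomputable def om0L (g : ℕ) : L g := ∑ i : Fin g, ⁅iotaL g (xB g i), iotaL g (yB g i)⁆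

/-- the degree `k` part `𝔩_g(k)` of the Lie algebra of symplectic derivations of `L`:
linear maps `D : H → L(k+1)` whose unique extension to a derivation `D̃` of `L`
kills `ω₀`. -/
def lset (g k : ℕ) : Set (H g →ₗ[ℚ] ↥(LS g (k+1))) :=
  {D | ∃ d : LieDerivation ℚ (L g) (L g),
        (∀ u : H g, d (iotaL g u) = (D u : L g)) ∧ d (om0L g) = 0}

/-- the map `D ↦ Σᵢ (xᵢ ⊗ D(yᵢ) - yᵢ ⊗ D(xᵢ))` from `Hom(H, L(k+1))` to `H ⊗ L(k+1)` -/
noncomputable def Phi (g k : ℕ) :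
    (H g →ₗ[ℚ] ↥(LS g (k+1))) →ₗ[ℚ] (H g ⊗[ℚ] ↥(LS g (k+1))) :=
  ∑ i : Fin g,
    ((TensorProduct.mk ℚ (H g) ↥(LS g (k+1)) (xB g i)) ∘ₗ LinearMap.applyₗ (yB g i)
      - (TensorProduct.mk ℚ (H g) ↥(LS g (k+1)) (yB g i)) ∘ₗ LinearMap.applyₗ (xB g i))

/-- the bracket map `H ⊗ L(k+1) → L`, `u ⊗ ξ ↦ [ι(u), ξ]` (its image lies in `L(k+2)`,
and its kernel does not depend on whether the codomain is restricted to `L(k+2)`). -/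
noncomputable def betaL (g k : ℕ) : (H g ⊗[ℚ] ↥(LS g (k+1))) →ₗ[ℚ] L g :=
  TensorProduct.lift
    (LinearMap.mk₂ ℚ (fun u ξ => ⁅iotaL g u, (ξ : L g)⁆)
      (fun u u' ξ => by simp [add_lie])
      (fun a u ξ => by simp [smul_lie])
      (fun u ξ ξ' => by simp [lie_add])
      (fun a u ξ => by simp [lie_smul]))

open LieAlgebra in
/-- Every map from the generators of a free Lie algebra to a Lie module extends to a derivation. -/
theorem FreeLieAlgebra.exists_lieDerivation_of_apply {R X M : Type*} [CommRing R]
    [AddCommGroup M] [Module R M] [LieRingModule (FreeLieAlgebra R X) M]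
    [LieModule R (FreeLieAlgebra R X) M] (f : X → M) :
    ∃ d : LieDerivation R (FreeLieAlgebra R X) M, ∀ x, d (of R x) = f x := by
  let c : LieModule.Cohomology.twoCocycle R (FreeLieAlgebra R X) M := 0
  let F : FreeLieAlgebra R X →ₗ⁅R⁆ ofTwoCocycle c := lift R fun x ↦ ofProd c (of R x, f x)
  let p : ofTwoCocycle c →ₗ⁅R⁆ FreeLieAlgebra R X :=
    { toFun x := ((ofProd c).symm x).1
      map_add' _ _ := by simp
      map_smul' _ _ := by simp
      map_lie' {_ _} := by simp [bracket_ofTwoCocycle] }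
  have hp : p.comp F = LieHom.id := by
    ext x
    change ((ofProd c).symm (F (of R x))).1 = of R x
    simp [F]
  have hfst (a : FreeLieAlgebra R X) : ((ofProd c).symm (F a)).1 = a :=
    LieHom.congr_fun hp a
  refine ⟨⟨⟨⟨fun a ↦ ((ofProd c).symm (F a)).2, fun a b ↦ by simp⟩, fun r a ↦ by simp⟩,
    fun a b ↦ ?_⟩, fun x ↦ ?_⟩
  · change ((ofProd c).symm (F ⁅a, b⁆)).2 = _
    rw [LieHom.map_lie, bracket_ofTwoCocycle, hfst, hfst]
    simp [c]
  · change ((ofProd c).symm (F (of R x))).2 = _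
    simp [F]

theorem iotaL_single (g : ℕ) (j : I g) : iotaL g (Pi.single j 1) = FreeLieAlgebra.of ℚ j := by
  rcases j with j | j <;> simp [iotaL, Pi.single_apply]

theorem exists_lieDerivation_extending (g : ℕ) (D : H g →ₗ[ℚ] L g) :
    ∃ d : LieDerivation ℚ (L g) (L g), ∀ u, d (iotaL g u) = D u := by
  obtain ⟨d, hd⟩ := FreeLieAlgebra.exists_lieDerivation_of_apply (R := ℚ)
    fun j : I g ↦ D (Pi.single j 1)
  refine ⟨d, LinearMap.congr_fun (f := (d : L g →ₗ[ℚ] L g) ∘ₗ iotaL g) ?_⟩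
  refine LinearMap.pi_ext' fun j ↦ LinearMap.ext_ring ?_
  simp [iotaL_single, hd]

theorem Phi_apply (g k : ℕ) (D : H g →ₗ[ℚ] ↥(LS g (k+1))) :
    Phi g k D = ∑ i, (xB g i ⊗ₜ[ℚ] D (yB g i) - yB g i ⊗ₜ[ℚ] D (xB g i)) := by
  simp [Phi]

/-- The derivation extending `D` sends `ω₀` to the bracket of `Φ(D)`. -/
theorem lieDerivation_om0L (g k : ℕ) (D : H g →ₗ[ℚ] ↥(LS g (k+1)))
    (d : LieDerivation ℚ (L g) (L g)) (hd : ∀ u, d (iotaL g u) = (D u : L g)) :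
    d (om0L g) = betaL g k (Phi g k D) := by
  simp [om0L, Phi_apply, hd, betaL]

theorem mem_lset_iff (g k : ℕ) (D : H g →ₗ[ℚ] ↥(LS g (k+1))) :
    D ∈ lset g k ↔ betaL g k (Phi g k D) = 0 := by
  constructor
  · rintro ⟨d, hd, h⟩
    rw [← lieDerivation_om0L g k D d hd, h]
  · intro h
    obtain ⟨d, hd⟩ := exists_lieDerivation_extending g ((LS g (k+1)).subtype ∘ₗ D)
    exact ⟨d, hd, (lieDerivation_om0L g k D d hd).trans h⟩

theorem Phi_injective (g k : ℕ) : Function.Injective (Phi g k) := by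
  rw [← LinearMap.ker_eq_bot, LinearMap.ker_eq_bot']
  intro D hD
  have coord (j : I g) : TensorProduct.lid ℚ _
      ((LinearMap.proj j : H g →ₗ[ℚ] ℚ).rTensor ↥(LS g (k+1)) (Phi g k D)) = 0 := by
    simp [hD]
  refine LinearMap.pi_ext' fun j ↦ LinearMap.ext_ring ?_
  rcases j with i | i
  · simpa [Phi_apply, xB, yB, Pi.single_apply, ite_smul] using coord (Sum.inr i)
  · simpa [Phi_apply, xB, yB, Pi.single_apply, ite_smul] using coord (Sum.inl i)

theorem Phi_surjective (g k : ℕ) : Function.Surjective (Phi g k) := by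
  intro z
  induction z with
  | zero => exact ⟨0, map_zero _⟩
  | add a b ha hb =>
    obtain ⟨D, rfl⟩ := ha
    obtain ⟨E, rfl⟩ := hb
    exact ⟨D + E, map_add _ _ _⟩
  | tmul u ξ =>
    let φ : H g →ₗ[ℚ] ℚ := ∑ i : Fin g,
      (u (Sum.inl i) • LinearMap.proj (Sum.inr i) - u (Sum.inr i) • LinearMap.proj (Sum.inl i))
    have hy (i : Fin g) : φ (yB g i) = u (Sum.inl i) := by simp [φ, yB, Pi.single_apply]
    have hx (i : Fin g) : φ (xB g i) = -u (Sum.inr i) := by simp [φ, xB, Pi.single_apply]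
    have hu : u = ∑ i, (u (Sum.inl i) • xB g i + u (Sum.inr i) • yB g i) := by
      ext (j | j) <;> simp [xB, yB, Pi.single_apply]
    refine ⟨φ.smulRight ξ, ?_⟩
    conv_rhs => rw [hu]
    simp [Phi_apply, hx, hy, TensorProduct.sum_tmul, TensorProduct.add_tmul,
      TensorProduct.smul_tmul, TensorProduct.tmul_neg, Finset.sum_add_distrib]

/-- for every `k ≥ 1`, the map `D ↦ Σᵢ (xᵢ ⊗ D(yᵢ) - yᵢ ⊗ D(xᵢ))` is a linear
isomorphism from `𝔩_g(k)` onto the kernel of the bracket map `H ⊗ L(k+1) → L(k+2)`. -/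
theorem stmt2 (g k : ℕ) (hg : 1 ≤ g) (hk : 1 ≤ k) :
    Set.InjOn (Phi g k) (lset g k) ∧
    Phi g k '' (lset g k) = (LinearMap.ker (betaL g k) : Set _) := by
  refine ⟨(Phi_injective g k).injOn, Set.ext fun z ↦ ⟨?_, fun hz ↦ ?_⟩⟩
  · rintro ⟨D, hD, rfl⟩
    exact (mem_lset_iff g k D).1 hD
  · obtain ⟨D, rfl⟩ := Phi_surjective g k z
    exact ⟨D, (mem_lset_iff g k D).2 hz, rfl⟩
end

section
/- For every g ≥ 1, the linear map Λ³H → H ⊗ L(2) sending u∧v∧w to u⊗[ι(v),ι(w)] + v⊗[ι(w),ι(u)] + w⊗[ι(u),ι(v)] is injective, and its image equals the kernel of the bracket map H ⊗ L(2) → L(3), u⊗ξ ↦ [ι(u), ξ]. (In particular 𝔩_g(1) ≅ Λ³H.) -/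
set_option maxSynthPendingDepth 2

open scoped TensorProduct

/-- `[ι(v), ι(w)]` as an element of `L(2)` -/
noncomputable def br2 (g : ℕ) (v w : H g) : ↥(LS g 2) :=
  ⟨⁅iotaL g v, iotaL g w⁆, by
    apply Submodule.subset_span
    exact ⟨v, iotaL g w, ⟨w, rfl⟩, rfl⟩⟩

/-- the wedge product `u ∧ v ∧ w` as an element of the third exterior power `Λ³H` -/
noncomputable def wedge3 (g : ℕ) (u v w : H g) : ↥(⋀[ℚ]^3 (H g)) :=
  ⟨ExteriorAlgebra.ιMulti ℚ 3 ![u, v, w],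
    ExteriorAlgebra.ιMulti_range ℚ 3 (Set.mem_range_self _)⟩

/-! ### The free Lie algebra in low degrees -/

theorem isLinearMap_br2_left (g : ℕ) (w : H g) : IsLinearMap ℚ (fun v => br2 g v w) :=
  ⟨fun a b => Subtype.ext (by simp [br2, add_lie]),
    fun a b => Subtype.ext (by simp [br2, smul_lie])⟩

theorem isLinearMap_br2_right (g : ℕ) (v : H g) : IsLinearMap ℚ (fun w => br2 g v w) :=
  ⟨fun a b => Subtype.ext (by simp [br2, lie_add]),
    fun a b => Subtype.ext (by simp [br2, lie_smul])⟩

theorem br2_self (g : ℕ) (v : H g) : br2 g v v = 0 :=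
  Subtype.ext (lie_self _)

theorem br2_swap (g : ℕ) (v w : H g) : br2 g w v = -br2 g v w :=
  Subtype.ext (lie_skew _ _).symm

theorem span_br2 (g : ℕ) :
    Submodule.span ℚ {ξ : ↥(LS g 2) | ∃ v w, br2 g v w = ξ} = ⊤ := by
  apply Submodule.map_injective_of_injective (LS g 2).subtype_injective
  rw [Submodule.map_span, Submodule.map_subtype_top]
  refine congrArg (Submodule.span ℚ) (Set.ext fun z => ⟨?_, ?_⟩)
  · rintro ⟨_, ⟨v, w, rfl⟩, rfl⟩
    exact ⟨v, iotaL g w, ⟨w, rfl⟩, rfl⟩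
  · rintro ⟨v, _, ⟨w, rfl⟩, rfl⟩
    exact ⟨br2 g v w, ⟨v, w, rfl⟩, rfl⟩

/-- Linear maps out of `L(2)` agreeing on brackets are equal. -/
theorem linearMap_LS_two_ext {g : ℕ} {M : Type*} [AddCommGroup M] [Module ℚ M]
    {p q : ↥(LS g 2) →ₗ[ℚ] M} (h : ∀ v w, p (br2 g v w) = q (br2 g v w)) : p = q := by
  apply LinearMap.ext_on (span_br2 g)
  rintro _ ⟨v, w, rfl⟩
  exact h v w

/-- Linear maps out of `H ⊗ L(2)` agreeing on the tensors `u ⊗ [v, w]` are equal. -/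
theorem linearMap_tensor_ext {g : ℕ} {M : Type*} [AddCommGroup M] [Module ℚ M]
    {p q : H g ⊗[ℚ] ↥(LS g 2) →ₗ[ℚ] M}
    (h : ∀ u v w, p (u ⊗ₜ br2 g v w) = q (u ⊗ₜ br2 g v w)) : p = q :=
  TensorProduct.ext <| LinearMap.ext fun u => linearMap_LS_two_ext fun v w => h u v w

section Words

attribute [local instance] LieRing.ofAssociativeRing LieAlgebra.ofAssociativeAlgebra

/-- The representation of `L` by strictly upper triangular matrices whose upper right entry is
the coefficient of the word `ijk`. -/
noncomputable def wordRep (g : ℕ) (i j k : I g) : L g →ₗ⁅ℚ⁆ Matrix (Fin 4) (Fin 4) ℚ :=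
  FreeLieAlgebra.lift ℚ fun a =>
    !![0, if a = i then 1 else 0, 0, 0;
       0, 0, if a = j then 1 else 0, 0;
       0, 0, 0, if a = k then 1 else 0;
       0, 0, 0, 0]

theorem wordRep_iotaL (g : ℕ) (i j k : I g) (u : H g) :
    wordRep g i j k (iotaL g u) = !![0, u i, 0, 0; 0, 0, u j, 0; 0, 0, 0, u k; 0, 0, 0, 0] := by
  have : wordRep g i j k (iotaL g u) = ∑ a, u a • wordRep g i j k (FreeLieAlgebra.of ℚ a) := by
    change (wordRep g i j k : L g →ₗ[ℚ] Matrix (Fin 4) (Fin 4) ℚ)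
      (∑ a : I g, u a • FreeLieAlgebra.of ℚ a) = _
    rw [map_sum]
    exact Finset.sum_congr rfl fun a _ => map_smul _ _ _
  rw [this]
  ext a b
  simp only [wordRep, FreeLieAlgebra.lift_of_apply, Matrix.sum_apply, Matrix.smul_apply]
  fin_cases a <;> fin_cases b <;> simp

/-- A matrix entry of `wordRep`, as a functional on `L(2)`. -/
noncomputable def wordEntry (g : ℕ) (i j k : I g) (a b : Fin 4) : ↥(LS g 2) →ₗ[ℚ] ℚ :=
  (Matrix.entryLinearMap ℚ ℚ a b) ∘ₗ
    (wordRep g i j k : L g →ₗ[ℚ] Matrix (Fin 4) (Fin 4) ℚ) ∘ₗ (LS g 2).subtype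

theorem wordEntry_apply (g : ℕ) (i j k : I g) (a b : Fin 4) (ξ : ↥(LS g 2)) :
    wordEntry g i j k a b ξ = wordRep g i j k ξ a b := rfl

theorem wordRep_br2 (g : ℕ) (i j k : I g) (v w : H g) :
    wordRep g i j k (br2 g v w) =
      !![0, 0, v i * w j - w i * v j, 0; 0, 0, 0, v j * w k - w j * v k;
         0, 0, 0, 0; 0, 0, 0, 0] := by
  simp only [br2, LieHom.map_lie, wordRep_iotaL, LieRing.of_associative_ring_bracket]
  ext a b
  fin_cases a <;> fin_cases b <;> simp

/-- The coefficient of the word `jk` in an element of `L(2)`. -/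
noncomputable def coeff2 (g : ℕ) (j k : I g) : ↥(LS g 2) →ₗ[ℚ] ℚ := wordEntry g j k k 0 2

theorem coeff2_br2 (g : ℕ) (j k : I g) (v w : H g) :
    coeff2 g j k (br2 g v w) = v j * w k - w j * v k := by
  rw [coeff2, wordEntry_apply, wordRep_br2]
  rfl

theorem wordEntry_zero_two (g : ℕ) (i j k : I g) : wordEntry g i j k 0 2 = coeff2 g i j :=
  linearMap_LS_two_ext fun v w => by
    rw [coeff2_br2, wordEntry_apply, wordRep_br2]
    rfl

theorem wordEntry_one_three (g : ℕ) (i j k : I g) : wordEntry g i j k 1 3 = coeff2 g j k :=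
  linearMap_LS_two_ext fun v w => by
    rw [coeff2_br2, wordEntry_apply, wordRep_br2]
    rfl

/-- The coordinates of an element of `H ⊗ L(2) ⊆ H ⊗ H ⊗ H`. -/
noncomputable def coeff3 (g : ℕ) (i j k : I g) : H g ⊗[ℚ] ↥(LS g 2) →ₗ[ℚ] ℚ :=
  LinearMap.mul' ℚ ℚ ∘ₗ TensorProduct.map (LinearMap.proj i) (coeff2 g j k)

theorem coeff3_tmul (g : ℕ) (i j k : I g) (u : H g) (ξ : ↥(LS g 2)) :
    coeff3 g i j k (u ⊗ₜ ξ) = u i * coeff2 g j k ξ := rfl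

theorem wordRep_betaL (g : ℕ) (i j k : I g) (t : H g ⊗[ℚ] ↥(LS g 2)) :
    wordRep g i j k (betaL g 1 t) 0 3 = coeff3 g i j k t - coeff3 g k i j t := by
  have : (Matrix.entryLinearMap ℚ ℚ (0 : Fin 4) (3 : Fin 4)) ∘ₗ
      (wordRep g i j k : L g →ₗ[ℚ] Matrix (Fin 4) (Fin 4) ℚ) ∘ₗ betaL g 1 =
      coeff3 g i j k - coeff3 g k i j := by
    refine TensorProduct.ext' fun u ξ => ?_
    change wordRep g i j k ⁅iotaL g u, (ξ : L g)⁆ 0 3 =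
      coeff3 g i j k (u ⊗ₜ ξ) - coeff3 g k i j (u ⊗ₜ ξ)
    rw [coeff3_tmul, coeff3_tmul, ← wordEntry_zero_two g i j k, ← wordEntry_one_three g i j k,
      wordEntry_apply, wordEntry_apply, LieHom.map_lie, wordRep_iotaL,
      LieRing.of_associative_ring_bracket, Matrix.sub_apply, Matrix.mul_apply, Matrix.mul_apply,
      Fin.sum_univ_four, Fin.sum_univ_four]
    simp [mul_comm]
  exact LinearMap.congr_fun this t

end Words

theorem coeff3_cyclic {g : ℕ} {t : H g ⊗[ℚ] ↥(LS g 2)} (ht : betaL g 1 t = 0) (i j k : I g) :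
    coeff3 g i j k t = coeff3 g k i j t := by
  have := wordRep_betaL g i j k t
  rw [ht, map_zero] at this
  exact sub_eq_zero.mp this.symm

/-! ### Expansion of trilinear maps in coordinates -/

theorem isLinearMap_expand {g : ℕ} {M : Type*} [AddCommGroup M] [Module ℚ M] {f : H g → M}
    (hf : IsLinearMap ℚ f) (u : H g) : ∑ i, u i • f (Pi.single i 1) = f u := by
  conv_rhs => rw [← IsLinearMap.mk'_apply hf, pi_eq_sum_univ' u, map_sum]
  refine Finset.sum_congr rfl fun i _ => ?_
  rw [map_smul, IsLinearMap.mk'_apply]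

theorem trilinear_expand {g : ℕ} {M : Type*} [AddCommGroup M] [Module ℚ M]
    {f : H g → H g → H g → M} (h₁ : ∀ v w, IsLinearMap ℚ fun u => f u v w)
    (h₂ : ∀ u w, IsLinearMap ℚ fun v => f u v w) (h₃ : ∀ u v, IsLinearMap ℚ fun w => f u v w)
    (u v w : H g) :
    ∑ i, ∑ j, ∑ k, (u i * v j * w k) • f (Pi.single i 1) (Pi.single j 1) (Pi.single k 1) =
      f u v w := by
  simp only [mul_smul, ← Finset.smul_sum]
  simp only [isLinearMap_expand (h₃ _ _) w, isLinearMap_expand (h₂ _ w) v,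
    isLinearMap_expand (h₁ v w) u]

/-- Substituting basis vectors into a trilinear map, with the coordinates of a tensor in
`H ⊗ L(2)` as coefficients. -/
noncomputable def coeffSum {g : ℕ} {M : Type*} [AddCommGroup M] [Module ℚ M]
    (f : H g → H g → H g → M) : H g ⊗[ℚ] ↥(LS g 2) →ₗ[ℚ] M :=
  ∑ i, ∑ j, ∑ k,
    (coeff3 g i j k).smulRight (f (Pi.single i 1) (Pi.single j 1) (Pi.single k 1))

theorem coeffSum_apply {g : ℕ} {M : Type*} [AddCommGroup M] [Module ℚ M]
    (f : H g → H g → H g → M) (t : H g ⊗[ℚ] ↥(LS g 2)) :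
    coeffSum f t = ∑ i, ∑ j, ∑ k,
      coeff3 g i j k t • f (Pi.single i 1) (Pi.single j 1) (Pi.single k 1) := by
  simp [coeffSum]

theorem coeffSum_tmul_br2 {g : ℕ} {M : Type*} [AddCommGroup M] [Module ℚ M]
    {f : H g → H g → H g → M} (h₁ : ∀ v w, IsLinearMap ℚ fun u => f u v w)
    (h₂ : ∀ u w, IsLinearMap ℚ fun v => f u v w) (h₃ : ∀ u v, IsLinearMap ℚ fun w => f u v w)
    (u v w : H g) : coeffSum f (u ⊗ₜ br2 g v w) = f u v w - f u w v := by
  rw [coeffSum_apply, ← trilinear_expand h₁ h₂ h₃ u v w, ← trilinear_expand h₁ h₂ h₃ u w v]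
  simp only [coeff3_tmul, coeff2_br2, mul_sub, sub_smul, Finset.sum_sub_distrib, mul_assoc]

theorem coeffSum_rotate {g : ℕ} {M : Type*} [AddCommGroup M] [Module ℚ M]
    (f : H g → H g → H g → M) {t : H g ⊗[ℚ] ↥(LS g 2)} (ht : betaL g 1 t = 0) :
    coeffSum (fun u v w => f v w u) t = coeffSum f t := by
  rw [coeffSum_apply, coeffSum_apply, Finset.sum_comm]
  refine Finset.sum_congr rfl fun j _ => ?_
  rw [Finset.sum_comm]
  refine Finset.sum_congr rfl fun k _ => Finset.sum_congr rfl fun i _ => ?_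
  rw [coeff3_cyclic ht j k i]

/-! ### The map out of the exterior cube -/

theorem isLinearMap_tmul_br2₁ (g : ℕ) (v w : H g) :
    IsLinearMap ℚ fun u : H g => u ⊗ₜ[ℚ] br2 g v w :=
  ⟨fun _ _ => TensorProduct.add_tmul _ _ _, fun _ _ => rfl⟩

theorem isLinearMap_tmul_br2₂ (g : ℕ) (u w : H g) :
    IsLinearMap ℚ fun v : H g => u ⊗ₜ[ℚ] br2 g v w :=
  (TensorProduct.mk ℚ (H g) ↥(LS g 2) u ∘ₗ (isLinearMap_br2_left g w).mk' _).isLinear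

theorem isLinearMap_tmul_br2₃ (g : ℕ) (u v : H g) :
    IsLinearMap ℚ fun w : H g => u ⊗ₜ[ℚ] br2 g v w :=
  (TensorProduct.mk ℚ (H g) ↥(LS g 2) u ∘ₗ (isLinearMap_br2_right g v).mk' _).isLinear

theorem coeffSum_tmul (g : ℕ) (t : H g ⊗[ℚ] ↥(LS g 2)) :
    coeffSum (fun u v w => u ⊗ₜ[ℚ] br2 g v w) t = (2 : ℚ) • t := by
  have : coeffSum (fun u v w => u ⊗ₜ[ℚ] br2 g v w) = (2 : ℚ) • LinearMap.id := by
    refine linearMap_tensor_ext fun u v w => ?_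
    rw [coeffSum_tmul_br2 (isLinearMap_tmul_br2₁ g) (isLinearMap_tmul_br2₂ g)
      (isLinearMap_tmul_br2₃ g), br2_swap g v w, TensorProduct.tmul_neg, sub_neg_eq_add,
      ← two_smul ℚ]
    rfl
  rw [this]
  rfl

/-- The trilinear map `(u, v, w) ↦ u ⊗ [v, w] + v ⊗ [w, u] + w ⊗ [u, v]`. -/
noncomputable def cyclicBracketMultilinear (g : ℕ) :
    MultilinearMap ℚ (fun _ : Fin 3 => H g) (H g ⊗[ℚ] ↥(LS g 2)) :=
  MultilinearMap.mk'
    (fun m => m 0 ⊗ₜ br2 g (m 1) (m 2) + m 1 ⊗ₜ br2 g (m 2) (m 0) + m 2 ⊗ₜ br2 g (m 0) (m 1))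
    (fun m i x y => by
      fin_cases i <;>
        simp [Function.update, (isLinearMap_tmul_br2₁ g _ _).map_add,
          (isLinearMap_tmul_br2₂ g _ _).map_add, (isLinearMap_tmul_br2₃ g _ _).map_add] <;> abel)
    (fun m i c x => by
      fin_cases i <;>
        simp [Function.update, (isLinearMap_tmul_br2₁ g _ _).map_smul,
          (isLinearMap_tmul_br2₂ g _ _).map_smul, (isLinearMap_tmul_br2₃ g _ _).map_smul])

theorem cyclicBracketMultilinear_apply (g : ℕ) (m : Fin 3 → H g) :
    cyclicBracketMultilinear g m =
      m 0 ⊗ₜ br2 g (m 1) (m 2) + m 1 ⊗ₜ br2 g (m 2) (m 0) + m 2 ⊗ₜ br2 g (m 0) (m 1) := rfl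

theorem cyclicBracketMultilinear_eq_zero (g : ℕ) (m : Fin 3 → H g)
    (h : m 0 = m 1 ∨ m 0 = m 2 ∨ m 1 = m 2) : cyclicBracketMultilinear g m = 0 := by
  rw [cyclicBracketMultilinear_apply]
  rcases h with h | h | h
  · rw [h, br2_self, br2_swap g (m 1) (m 2), TensorProduct.tmul_neg, TensorProduct.tmul_zero]
    abel
  · rw [h, br2_self, br2_swap g (m 1) (m 2), TensorProduct.tmul_neg, TensorProduct.tmul_zero]
    abel
  · rw [h, br2_self, br2_swap g (m 2) (m 0), TensorProduct.tmul_neg, TensorProduct.tmul_zero]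
    abel

/-- The alternating map `(u, v, w) ↦ u ⊗ [v, w] + v ⊗ [w, u] + w ⊗ [u, v]`. -/
noncomputable def cyclicBracket (g : ℕ) : H g [⋀^Fin 3]→ₗ[ℚ] H g ⊗[ℚ] ↥(LS g 2) where
  toMultilinearMap := cyclicBracketMultilinear g
  map_eq_zero_of_eq' m i j h hij := by
    refine cyclicBracketMultilinear_eq_zero g m ?_
    fin_cases i <;> fin_cases j <;>
      first
      | exact absurd rfl hij
      | exact Or.inl h
      | exact Or.inl h.symm
      | exact Or.inr (Or.inl h)
      | exact Or.inr (Or.inl h.symm)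
      | exact Or.inr (Or.inr h)
      | exact Or.inr (Or.inr h.symm)

theorem coe_wedge3 (g : ℕ) (u v w : H g) : (wedge3 g u v w : ExteriorAlgebra ℚ (H g)) =
    ExteriorAlgebra.ι ℚ u * (ExteriorAlgebra.ι ℚ v * ExteriorAlgebra.ι ℚ w) := by
  simp [wedge3, ExteriorAlgebra.ιMulti_apply]

theorem isLinearMap_wedge3₁ (g : ℕ) (v w : H g) : IsLinearMap ℚ fun u => wedge3 g u v w :=
  ⟨fun _ _ => Subtype.ext (by simp [coe_wedge3, add_mul]),
    fun _ _ => Subtype.ext (by simp [coe_wedge3])⟩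

theorem isLinearMap_wedge3₂ (g : ℕ) (u w : H g) : IsLinearMap ℚ fun v => wedge3 g u v w :=
  ⟨fun _ _ => Subtype.ext (by simp [coe_wedge3, add_mul, mul_add]),
    fun _ _ => Subtype.ext (by simp [coe_wedge3])⟩

theorem isLinearMap_wedge3₃ (g : ℕ) (u v : H g) : IsLinearMap ℚ fun w => wedge3 g u v w :=
  ⟨fun _ _ => Subtype.ext (by simp [coe_wedge3, mul_add]),
    fun _ _ => Subtype.ext (by simp [coe_wedge3])⟩

theorem ι_mul_ι_swap (g : ℕ) (v w : H g) : ExteriorAlgebra.ι ℚ w * ExteriorAlgebra.ι ℚ v =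
    -(ExteriorAlgebra.ι ℚ v * ExteriorAlgebra.ι ℚ w) :=
  eq_neg_of_add_eq_zero_left (ExteriorAlgebra.ι_add_mul_swap w v)

theorem wedge3_swap (g : ℕ) (u v w : H g) : wedge3 g u w v = -wedge3 g u v w :=
  Subtype.ext (by
    rw [NegMemClass.coe_neg, coe_wedge3, coe_wedge3, ι_mul_ι_swap g v w, mul_neg])

theorem wedge3_rotate (g : ℕ) (u v w : H g) : wedge3 g v w u = wedge3 g u v w :=
  Subtype.ext (by
    rw [coe_wedge3, coe_wedge3, ι_mul_ι_swap g u w, mul_neg, ← mul_assoc, ι_mul_ι_swap g u v,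
      neg_mul, neg_neg, mul_assoc])

theorem linearMap_wedge3_ext {g : ℕ} {M : Type*} [AddCommGroup M] [Module ℚ M]
    {p q : ↥(⋀[ℚ]^3 (H g)) →ₗ[ℚ] M}
    (h : ∀ u v w, p (wedge3 g u v w) = q (wedge3 g u v w)) : p = q := by
  refine exteriorPower.linearMap_ext (AlternatingMap.ext fun m => ?_)
  have : m = ![m 0, m 1, m 2] := by
    ext i : 1
    fin_cases i <;> rfl
  rw [this]
  exact h _ _ _

/-- The linear map `Λ³H → H ⊗ L(2)`. -/
noncomputable def wedgeToTensor (g : ℕ) : ↥(⋀[ℚ]^3 (H g)) →ₗ[ℚ] H g ⊗[ℚ] ↥(LS g 2) :=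
  exteriorPower.alternatingMapLinearEquiv (cyclicBracket g)

theorem wedgeToTensor_wedge3 (g : ℕ) (u v w : H g) : wedgeToTensor g (wedge3 g u v w) =
    u ⊗ₜ br2 g v w + v ⊗ₜ br2 g w u + w ⊗ₜ br2 g u v :=
  exteriorPower.alternatingMapLinearEquiv_apply_ιMulti (cyclicBracket g) ![u, v, w]

theorem coeffSum_wedge3_wedgeToTensor (g : ℕ) (z : ↥(⋀[ℚ]^3 (H g))) :
    coeffSum (wedge3 g) (wedgeToTensor g z) = (6 : ℚ) • z := by
  have : coeffSum (wedge3 g) ∘ₗ wedgeToTensor g = (6 : ℚ) • LinearMap.id := by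
    refine linearMap_wedge3_ext fun u v w => ?_
    have key (a b c : H g) : coeffSum (wedge3 g) (a ⊗ₜ br2 g b c) = (2 : ℚ) • wedge3 g a b c := by
      rw [coeffSum_tmul_br2 (isLinearMap_wedge3₁ g) (isLinearMap_wedge3₂ g)
        (isLinearMap_wedge3₃ g), wedge3_swap g a b c, sub_neg_eq_add, ← two_smul ℚ]
    rw [LinearMap.comp_apply, wedgeToTensor_wedge3, map_add, map_add, key, key, key,
      wedge3_rotate g u v w, wedge3_rotate g w u v, ← add_smul, ← add_smul, LinearMap.smul_apply,
      LinearMap.id_apply]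
    norm_num
  exact LinearMap.congr_fun this z

theorem wedgeToTensor_coeffSum_wedge3 {g : ℕ} {t : H g ⊗[ℚ] ↥(LS g 2)} (ht : betaL g 1 t = 0) :
    wedgeToTensor g (coeffSum (wedge3 g) t) = (6 : ℚ) • t := by
  have h₁ := coeffSum_rotate (fun u v w => u ⊗ₜ[ℚ] br2 g v w) ht
  have h₂ := coeffSum_rotate (fun u v w => v ⊗ₜ[ℚ] br2 g w u) ht
  have h₃ : wedgeToTensor g (coeffSum (wedge3 g) t) =
      coeffSum (fun u v w => u ⊗ₜ[ℚ] br2 g v w) t + coeffSum (fun u v w => v ⊗ₜ[ℚ] br2 g w u) t +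
        coeffSum (fun u v w => w ⊗ₜ[ℚ] br2 g u v) t := by
    simp only [coeffSum_apply, map_sum, map_smul, wedgeToTensor_wedge3, smul_add,
      Finset.sum_add_distrib]
  rw [h₃, h₂, h₁, coeffSum_tmul, ← add_smul, ← add_smul]
  norm_num

theorem betaL_tmul_br2 (g : ℕ) (u v w : H g) :
    betaL g 1 (u ⊗ₜ br2 g v w) = ⁅iotaL g u, ⁅iotaL g v, iotaL g w⁆⁆ := rfl

theorem betaL_comp_wedgeToTensor (g : ℕ) : betaL g 1 ∘ₗ wedgeToTensor g = 0 :=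
  linearMap_wedge3_ext fun u v w => by
    rw [LinearMap.comp_apply, wedgeToTensor_wedge3, map_add, map_add, betaL_tmul_br2,
      betaL_tmul_br2, betaL_tmul_br2]
    exact lie_jacobi _ _ _

/-- for every `g ≥ 1`, the linear map `Λ³H → H ⊗ L(2)` sending `u∧v∧w` to
`u⊗[ι(v),ι(w)] + v⊗[ι(w),ι(u)] + w⊗[ι(u),ι(v)]` is injective and its image is exactly the
kernel of the bracket map `H ⊗ L(2) → L(3)`, `u⊗ξ ↦ [ι(u),ξ]`. -/
theorem stmt4 (g : ℕ) (hg : 1 ≤ g) :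
    ∃ F : ↥(⋀[ℚ]^3 (H g)) →ₗ[ℚ] (H g ⊗[ℚ] ↥(LS g 2)),
      (∀ u v w : H g,
        F (wedge3 g u v w) =
          u ⊗ₜ br2 g v w + v ⊗ₜ br2 g w u + w ⊗ₜ br2 g u v) ∧
      Function.Injective F ∧
      LinearMap.range F = LinearMap.ker (betaL g 1) := by
  refine ⟨wedgeToTensor g, wedgeToTensor_wedge3 g, fun z₁ z₂ h => ?_, le_antisymm ?_ fun t ht => ?_⟩
  · have := congrArg (coeffSum (wedge3 g)) h
    rw [coeffSum_wedge3_wedgeToTensor, coeffSum_wedge3_wedgeToTensor] at this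
    exact smul_right_injective _ (by norm_num : (6 : ℚ) ≠ 0) this
  · exact LinearMap.range_le_ker_iff.mpr (betaL_comp_wedgeToTensor g)
  · refine ⟨(6 : ℚ)⁻¹ • coeffSum (wedge3 g) t, ?_⟩
    rw [map_smul, wedgeToTensor_coeffSum_wedge3 ht, inv_smul_smul₀ (by norm_num)]
end

section
/- For g ≥ 2, the Lie algebra 𝔩_g⁺ is not finitely generated: there is no finite subset S ⊆ 𝔩_g⁺ such that the Lie subalgebra generated by S is all of 𝔩_g⁺. -/
set_option maxSynthPendingDepth 2

open scoped TensorProduct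

/-- `𝔩_g⁺`: the set of derivations `d` of `L` which kill `ω₀` and have positive degree,
i.e. map `ι(H)` into the commutator ideal `[L, L]`. -/
def lplus (g : ℕ) : Set (LieDerivation ℚ (L g) (L g)) :=
  {d | d (om0L g) = 0 ∧
    ∀ u : H g, d (iotaL g u) ∈ ⁅(⊤ : LieIdeal ℚ (L g)), (⊤ : LieIdeal ℚ (L g))⁆}

/-- The semidirect sum of a Lie algebra `K` and a `K`-module `M` seen as an abelian ideal. -/
def ModuleSemidirect (K M : Type*) := K × M

namespace ModuleSemidirect

section

variable {R K M : Type*} [CommRing R] [AddCommGroup K] [Module R K] [AddCommGroup M] [Module R M]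

instance : AddCommGroup (ModuleSemidirect K M) := inferInstanceAs (AddCommGroup (K × M))

instance : Module R (ModuleSemidirect K M) := inferInstanceAs (Module R (K × M))

@[simp] theorem fst_add (p q : ModuleSemidirect K M) : (p + q).1 = p.1 + q.1 := rfl

@[simp] theorem snd_add (p q : ModuleSemidirect K M) : (p + q).2 = p.2 + q.2 := rfl

@[simp] theorem fst_smul (t : R) (p : ModuleSemidirect K M) : (t • p).1 = t • p.1 := rfl

@[simp] theorem snd_smul (t : R) (p : ModuleSemidirect K M) : (t • p).2 = t • p.2 := rfl

@[simp] theorem fst_zero : (0 : ModuleSemidirect K M).1 = 0 := rfl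

@[simp] theorem snd_zero : (0 : ModuleSemidirect K M).2 = 0 := rfl

end

variable {R K M : Type*} [CommRing R] [LieRing K] [LieAlgebra R K]
  [AddCommGroup M] [Module R M] [LieRingModule K M] [LieModule R K M]

instance : Bracket (ModuleSemidirect K M) (ModuleSemidirect K M) where
  bracket p q := (⁅p.1, q.1⁆, ⁅p.1, q.2⁆ - ⁅q.1, p.2⁆)

@[simp] theorem fst_lie (p q : ModuleSemidirect K M) : ⁅p, q⁆.1 = ⁅p.1, q.1⁆ := rfl

@[simp] theorem snd_lie (p q : ModuleSemidirect K M) :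
    ⁅p, q⁆.2 = ⁅p.1, q.2⁆ - ⁅q.1, p.2⁆ := rfl

instance : LieRing (ModuleSemidirect K M) where
  add_lie p q r := Prod.ext (by simp) (by simp; abel)
  lie_add p q r := Prod.ext (by simp) (by simp; abel)
  lie_self p := Prod.ext (by simp) (by simp)
  leibniz_lie p q r := Prod.ext (by simp) (by simp; abel)

instance : LieAlgebra R (ModuleSemidirect K M) where
  lie_smul t p q := Prod.ext (by simp) (by simp [smul_sub])

variable (R K M) in
/-- The projection of the semidirect sum onto the acting Lie algebra. -/
def fstHom : ModuleSemidirect K M →ₗ⁅R⁆ K where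
  toFun p := p.1
  map_add' _ _ := rfl
  map_smul' _ _ := rfl
  map_lie' := rfl

end ModuleSemidirect

namespace FreeLieAlgebra

theorem lieSpan_range_of (R X : Type*) [CommRing R] :
    LieSubalgebra.lieSpan R (FreeLieAlgebra R X) (Set.range (of R)) = ⊤ := by
  set S := LieSubalgebra.lieSpan R (FreeLieAlgebra R X) (Set.range (of R))
  let r : FreeLieAlgebra R X →ₗ⁅R⁆ S :=
    lift R fun x => ⟨of R x, LieSubalgebra.subset_lieSpan ⟨x, rfl⟩⟩
  have h : S.incl.comp r = LieHom.id := hom_ext fun x => by simp [r]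
  refine eq_top_iff.2 fun a _ => ?_
  have ha : (r a : FreeLieAlgebra R X) = a := LieHom.congr_fun h a
  exact ha ▸ (r a).2

variable {R X : Type*} [CommRing R]

theorem induction {p : FreeLieAlgebra R X → Prop} (of_mem : ∀ x, p (of R x)) (zero : p 0)
    (add : ∀ a b, p a → p b → p (a + b)) (smul : ∀ (t : R) a, p a → p (t • a))
    (lie : ∀ a b, p a → p b → p ⁅a, b⁆) (a : FreeLieAlgebra R X) : p a := by
  have ha : a ∈ LieSubalgebra.lieSpan R (FreeLieAlgebra R X) (Set.range (of R)) := by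
    simp [lieSpan_range_of]
  induction ha using LieSubalgebra.lieSpan_induction with
  | mem b hb => obtain ⟨x, rfl⟩ := hb; exact of_mem x
  | zero => exact zero
  | add b c _ _ hb hc => exact add b c hb hc
  | smul t b _ hb => exact smul t b hb
  | lie b c _ _ hb hc => exact lie b c hb hc

variable {M : Type*} [AddCommGroup M] [Module R M] [LieRingModule (FreeLieAlgebra R X) M]
  [LieModule R (FreeLieAlgebra R X) M]

/-- The derivation of a free Lie algebra with prescribed values on the generators. -/
noncomputable def derivation (f : X → M) : LieDerivation R (FreeLieAlgebra R X) M :=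
  let F₀ : X → ModuleSemidirect (FreeLieAlgebra R X) M := fun x => (of R x, f x)
  let F := lift R F₀
  have hF (a : FreeLieAlgebra R X) : (F a).1 = a := by
    have h : (ModuleSemidirect.fstHom R (FreeLieAlgebra R X) M).comp F = LieHom.id :=
      hom_ext fun x => by
        rw [LieHom.comp_apply, lift_of_apply]; rfl
    exact LieHom.congr_fun h a
  { toFun := fun a => (F a).2
    map_add' := fun a b => by simp
    map_smul' := fun t a => by simp
    leibniz' := fun a b => by simp [hF] }

@[simp] theorem derivation_of (f : X → M) (x : X) : derivation f (of R x) = f x := by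
  let F₀ : X → ModuleSemidirect (FreeLieAlgebra R X) M := fun x => (of R x, f x)
  change (lift R F₀ (of R x)).2 = _
  rw [lift_of_apply]

section Fox

variable {A : Type*} [CommRing A] [Algebra R A]

attribute [local instance] LieRing.ofAssociativeRing

/-- The linear extension of `c : X → A` to the free Lie algebra vanishing on brackets. -/
noncomputable def abelianization (R : Type*) [CommRing R] [Algebra R A] (c : X → A) :
    FreeLieAlgebra R X →ₗ⁅R⁆ A := lift R c

variable (c : X → A)

@[simp] theorem abelianization_of (x : X) : abelianization R c (of R x) = c x :=
  lift_of_apply c x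

@[simp] theorem abelianization_lie (a b : FreeLieAlgebra R X) :
    abelianization R c ⁅a, b⁆ = 0 := by
  rw [LieHom.map_lie, LieRing.of_associative_ring_bracket, mul_comm, sub_self]

theorem abelianization_eq_zero {a : FreeLieAlgebra R X}
    (ha : a ∈ ⁅(⊤ : LieIdeal R (FreeLieAlgebra R X)), (⊤ : LieIdeal R (FreeLieAlgebra R X))⁆) :
    abelianization R c a = 0 := by
  have h : ⁅(⊤ : LieIdeal R (FreeLieAlgebra R X)), (⊤ : LieIdeal R (FreeLieAlgebra R X))⁆ ≤
      (abelianization R c).ker :=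
    (LieSubmodule.lie_le_iff ..).2 fun a _ b _ => by
      rw [LieHom.mem_ker, abelianization_lie]
  simpa using h ha

/-- Vectors over `A` indexed by `X`, on which a free Lie algebra acts by `abelianization R c`. -/
def FoxModule (_ : X → A) := X → A

noncomputable instance : AddCommGroup (FoxModule c) := inferInstanceAs (AddCommGroup (X → A))

noncomputable instance : Module R (FoxModule c) := inferInstanceAs (Module R (X → A))

noncomputable instance : LieRingModule (FreeLieAlgebra R X) (FoxModule c) where
  bracket a v := fun x => abelianization R c a * v x
  add_lie a b v := funext fun x => by
    change abelianization R c (a + b) * v x = _ + _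
    rw [map_add, add_mul]
  lie_add a v w := funext fun x => mul_add _ _ _
  leibniz_lie a b v := funext fun x => by
    change _ = abelianization R c ⁅a, b⁆ * v x + _
    rw [abelianization_lie, zero_mul, zero_add]
    exact mul_left_comm _ _ _

noncomputable instance : LieModule R (FreeLieAlgebra R X) (FoxModule c) where
  smul_lie t a v := funext fun x => by
    change abelianization R c (t • a) * v x = t • (abelianization R c a * v x)
    rw [map_smul, smul_mul_assoc]
  lie_smul t a v := funext fun x => mul_smul_comm _ _ _

theorem abelianization_derivation_apply
    {D : LieDerivation R (FreeLieAlgebra R X) (FreeLieAlgebra R X)}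
    (hD : ∀ x, abelianization R c (D (of R x)) = 0) (a : FreeLieAlgebra R X) :
    abelianization R c (D a) = 0 := by
  induction a using induction with
  | of_mem x => exact hD x
  | zero => simp
  | add a b ha hb => simp [ha, hb]
  | smul t a ha => simp [ha]
  | lie a b _ _ => rw [D.apply_lie_eq_sub, map_sub, abelianization_lie, abelianization_lie, sub_self]

variable [DecidableEq X]

/-- The vector of Fox derivatives with coefficients specialised along `c : X → A`. -/
noncomputable def fox (R : Type*) [CommRing R] [Algebra R A] (c : X → A) : FreeLieAlgebra R X →ₗ[R] (X → A) :=
  (derivation (R := R) (M := FoxModule c) fun x => (Pi.single x 1 : X → A)).toLinearMap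

@[simp] theorem fox_of (x : X) : fox R c (of R x) = Pi.single x 1 :=
  derivation_of (R := R) (M := FoxModule c) (fun x => (Pi.single x 1 : X → A)) x

theorem fox_lie (a b : FreeLieAlgebra R X) :
    fox R c ⁅a, b⁆ = abelianization R c a • fox R c b - abelianization R c b • fox R c a :=
  (derivation (R := R) (M := FoxModule c) fun x => (Pi.single x 1 : X → A)).leibniz' a b

theorem fox_iterate_lie_apply {w : FreeLieAlgebra R X} {x : X} (hw : fox R c w x = 0)
    (a : FreeLieAlgebra R X) (k : ℕ) :
    fox R c ((Bracket.bracket w)^[k] a) x = abelianization R c w ^ k * fox R c a x := by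
  induction k with
  | zero => simp
  | succ k ih => rw [Function.iterate_succ_apply', fox_lie]; simp [ih, hw]; ring

/-- The elements whose Fox derivative with respect to `x` vanishes. -/
noncomputable def foxKer (R : Type*) [CommRing R] [Algebra R A] (c : X → A) (x : X) :
    LieSubalgebra R (FreeLieAlgebra R X) where
  carrier := {a | fox R c a x = 0}
  zero_mem' := by simp
  add_mem' ha hb := by simp_all
  smul_mem' t a ha := by simp_all
  lie_mem' ha hb := by simp_all [fox_lie]

theorem mem_foxKer {x : X} {a : FreeLieAlgebra R X} : a ∈ foxKer R c x ↔ fox R c a x = 0 :=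
  Iff.rfl

/-- The Jacobian matrix of a derivation, made of specialised Fox derivatives. -/
noncomputable def jacobian (R : Type*) [CommRing R] [Algebra R A] (c : X → A) :
    LieDerivation R (FreeLieAlgebra R X) (FreeLieAlgebra R X) →ₗ[R] Matrix X X A where
  toFun D := Matrix.of fun x y => fox R c (D (of R y)) x
  map_add' D E := by ext; simp
  map_smul' t D := by ext; simp

theorem jacobian_apply (D : LieDerivation R (FreeLieAlgebra R X) (FreeLieAlgebra R X)) (x y : X) :
    jacobian R c D x y = fox R c (D (of R y)) x := rfl

variable [Fintype X]

theorem fox_derivation_apply {D : LieDerivation R (FreeLieAlgebra R X) (FreeLieAlgebra R X)}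
    (hD : ∀ x, abelianization R c (D (of R x)) = 0) (a : FreeLieAlgebra R X) :
    fox R c (D a) = (jacobian R c D).mulVec (fox R c a) := by
  induction a using induction with
  | of_mem x => ext; simp [jacobian_apply]
  | zero => simp
  | add a b ha hb => simp [ha, hb, Matrix.mulVec_add]
  | smul t a ha => simp [ha, Matrix.mulVec_smul]
  | lie a b ha hb =>
    simp only [D.apply_lie_eq_sub, map_sub, fox_lie, ha, hb,
      abelianization_derivation_apply c hD, zero_smul, sub_zero, Matrix.mulVec_sub,
      Matrix.mulVec_smul]

/-- The trace of the Jacobian matrix (the specialised divergence, or Morita trace). -/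
noncomputable def divergence (R : Type*) [CommRing R] [Algebra R A] (c : X → A) :
    LieDerivation R (FreeLieAlgebra R X) (FreeLieAlgebra R X) →ₗ[R] A :=
  Matrix.traceLinearMap X R A ∘ₗ jacobian R c

theorem divergence_apply (D : LieDerivation R (FreeLieAlgebra R X) (FreeLieAlgebra R X)) :
    divergence R c D = ∑ x, fox R c (D (of R x)) x := rfl

theorem divergence_lie {D E : LieDerivation R (FreeLieAlgebra R X) (FreeLieAlgebra R X)}
    (hD : ∀ x, abelianization R c (D (of R x)) = 0)
    (hE : ∀ x, abelianization R c (E (of R x)) = 0) :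
    divergence R c ⁅D, E⁆ = 0 := by
  have h : jacobian R c ⁅D, E⁆ =
      jacobian R c D * jacobian R c E - jacobian R c E * jacobian R c D := by
    ext x y
    rw [jacobian_apply, LieDerivation.commutator_apply, map_sub,
      fox_derivation_apply c hD (E _), fox_derivation_apply c hE (D _)]
    rfl
  rw [divergence, LinearMap.comp_apply, h, Matrix.traceLinearMap_apply, Matrix.trace_sub,
    Matrix.trace_mul_comm, sub_self]

end Fox

end FreeLieAlgebra

/-- Moving `k` applications of `ad w` from one side of a bracket to the other only changes the
bracket by a sign, modulo the image of `ad w`. -/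
theorem LieSubalgebra.exists_lie_iterate_sub_eq_lie {R K : Type*} [CommRing R] [LieRing K]
    [LieAlgebra R K] (T : LieSubalgebra R K) {w : K} (hw : w ∈ T) (k : ℕ) {a b : K} (ha : a ∈ T)
    (hb : b ∈ T) :
    ∃ z ∈ T, z ∈ ⁅(⊤ : LieIdeal R K), (⊤ : LieIdeal R K)⁆ ∧
      ⁅a, (Bracket.bracket w)^[k] b⁆ - (-1 : R) ^ k • ⁅(Bracket.bracket w)^[k] a, b⁆ = ⁅w, z⁆ := by
  induction k generalizing b with
  | zero => exact ⟨0, zero_mem _, zero_mem _, by simp⟩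
  | succ k ih =>
    obtain ⟨z, hzT, hz, h⟩ := ih (T.lie_mem hw hb)
    have hT : (Bracket.bracket w)^[k] a ∈ T := by
      clear ih h
      induction k with
      | zero => exact ha
      | succ k ih => rw [Function.iterate_succ_apply']; exact T.lie_mem hw ih
    refine ⟨z + (-1 : R) ^ k • ⁅(Bracket.bracket w)^[k] a, b⁆,
      add_mem hzT (T.smul_mem _ (T.lie_mem hT hb)),
      add_mem hz (SMulMemClass.smul_mem _ (LieSubmodule.lie_mem_lie trivial trivial)), ?_⟩
    rw [Function.iterate_succ_apply, Function.iterate_succ_apply', lie_add, ← h, lie_smul,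
      leibniz_lie w, pow_succ, smul_add]
    simp only [mul_neg, mul_one, neg_smul]
    abel

theorem exists_mem_lplus_divergence_eq (n : ℕ) {k : ℕ} (hk : Odd k) :
    ∃ D ∈ lplus (n + 2),
      FreeLieAlgebra.divergence ℚ
          (Pi.single (Sum.inl 1) Polynomial.X : I (n + 2) → Polynomial ℚ) D =
        2 * Polynomial.X ^ k := by
  set c : I (n + 2) → Polynomial ℚ := Pi.single (Sum.inl 1) Polynomial.X with hc
  let x : Fin (n + 2) → L (n + 2) := fun i => FreeLieAlgebra.of ℚ (Sum.inl i)
  let y : Fin (n + 2) → L (n + 2) := fun i => FreeLieAlgebra.of ℚ (Sum.inr i)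
  obtain ⟨z, hzT, hz, h⟩ := LieSubalgebra.exists_lie_iterate_sub_eq_lie
    (FreeLieAlgebra.foxKer ℚ c (Sum.inr 1)) (w := x 1) (a := x 0) (b := y 0)
    (by simp [FreeLieAlgebra.mem_foxKer, x]) k (by simp [FreeLieAlgebra.mem_foxKer, x])
    (by simp [FreeLieAlgebra.mem_foxKer, y])
  rw [hk.neg_one_pow, neg_one_smul, sub_neg_eq_add] at h
  rw [FreeLieAlgebra.mem_foxKer] at hzT
  let f : I (n + 2) → L (n + 2) := Sum.elim
    (Fin.cons ((Bracket.bracket (x 1))^[k] (x 0)) fun _ => 0)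
    (Fin.cons ((Bracket.bracket (x 1))^[k] (y 0)) (Fin.cons (-z) fun _ => 0))
  have hmem (a : L (n + 2)) : (Bracket.bracket (x 1))^[k] a ∈
      ⁅(⊤ : LieIdeal ℚ (L (n + 2))), (⊤ : LieIdeal ℚ (L (n + 2)))⁆ := by
    obtain ⟨m, rfl⟩ := Nat.exists_eq_add_one.2 hk.pos
    rw [Function.iterate_succ_apply']
    exact LieSubmodule.lie_mem_lie trivial trivial
  have hf (j : I (n + 2)) :
      f j ∈ ⁅(⊤ : LieIdeal ℚ (L (n + 2))), (⊤ : LieIdeal ℚ (L (n + 2)))⁆ := by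
    rcases j with i | i
    · refine Fin.cases ?_ (fun i => ?_) i
      · exact hmem _
      · exact zero_mem _
    · refine Fin.cases ?_ (fun i => ?_) i
      · exact hmem _
      · refine Fin.cases ?_ (fun i => ?_) i
        · exact neg_mem hz
        · exact zero_mem _
  refine ⟨FreeLieAlgebra.derivation f, ⟨?_, fun u => ?_⟩, ?_⟩
  · simp only [om0L, xB, yB, iotaL_single, Fin.sum_univ_succ, map_add, map_sum,
      LieDerivation.apply_lie_eq_add, FreeLieAlgebra.derivation_of, f, Sum.elim_inl, Sum.elim_inr,
      Fin.cons_zero, Fin.cons_succ, lie_zero, zero_lie, add_zero, Finset.sum_const_zero, lie_neg]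
    rw [← sub_eq_add_neg]
    exact sub_eq_zero.2 h
  · change FreeLieAlgebra.derivation f (∑ j, u j • FreeLieAlgebra.of ℚ j) ∈ _
    rw [map_sum]
    refine sum_mem fun j _ => ?_
    rw [map_smul, FreeLieAlgebra.derivation_of]
    exact SMulMemClass.smul_mem _ (hf j)
  · have hx := FreeLieAlgebra.fox_iterate_lie_apply c (w := x 1) (x := Sum.inl 0)
      (by simp [x]) (x 0) k
    have hy := FreeLieAlgebra.fox_iterate_lie_apply c (w := x 1) (x := Sum.inr 0)
      (by simp [x]) (y 0) k
    simp only [FreeLieAlgebra.divergence_apply, FreeLieAlgebra.derivation_of,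
      Fintype.sum_sum_type, Fin.sum_univ_succ, f, Sum.elim_inl, Sum.elim_inr,
      Fin.cons_zero, Fin.cons_succ, hx, hy]
    simp [x, y, hzT, two_mul]
    simp [hc]

/-- for `g ≥ 2`, the Lie algebra `𝔩_g⁺` is not finitely generated: there is no
finite subset `S ⊆ 𝔩_g⁺` whose generated Lie subalgebra is all of `𝔩_g⁺`. -/
theorem stmt6 (g : ℕ) (hg : 2 ≤ g) :
    ¬ ∃ S : Set (LieDerivation ℚ (L g) (L g)),
        S.Finite ∧ S ⊆ lplus g ∧
        ((LieSubalgebra.lieSpan ℚ (LieDerivation ℚ (L g) (L g)) S : Set _) = lplus g) := by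
  rintro ⟨S, hS, -, hspan⟩
  obtain ⟨n, rfl⟩ := Nat.exists_eq_add_of_le' hg
  set c : I (n + 2) → Polynomial ℚ := Pi.single (Sum.inl 1) Polynomial.X
  have hpos {D} (hD : D ∈ LieSubalgebra.lieSpan ℚ (LieDerivation ℚ (L (n + 2)) (L (n + 2))) S)
      (j : I (n + 2)) :
      FreeLieAlgebra.abelianization ℚ c (D (FreeLieAlgebra.of ℚ j)) = 0 := by
    rw [← SetLike.mem_coe, hspan] at hD
    rw [← iotaL_single]
    exact FreeLieAlgebra.abelianization_eq_zero c (hD.2 _)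
  obtain ⟨N, hN⟩ := (hS.image fun D => (FreeLieAlgebra.divergence ℚ c D).natDegree).bddAbove
  have hdeg {D} (hD : D ∈ LieSubalgebra.lieSpan ℚ (LieDerivation ℚ (L (n + 2)) (L (n + 2))) S) :
      FreeLieAlgebra.divergence ℚ c D ∈ Polynomial.degreeLE ℚ N := by
    induction hD using LieSubalgebra.lieSpan_induction with
    | mem D hD =>
      exact Polynomial.mem_degreeLE.2 (Polynomial.degree_le_of_natDegree_le (hN ⟨D, hD, rfl⟩))
    | zero => rw [map_zero]; exact zero_mem _
    | add D E _ _ hD hE => rw [map_add]; exact add_mem hD hE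
    | smul t D _ hD => rw [map_smul]; exact Submodule.smul_mem _ _ hD
    | lie D E hD hE _ _ =>
      rw [FreeLieAlgebra.divergence_lie c (hpos hD) (hpos hE)]
      exact zero_mem _
  obtain ⟨D, hD, hDdiv⟩ := exists_mem_lplus_divergence_eq n (odd_two_mul_add_one N)
  rw [← hspan] at hD
  have h := hdeg hD
  rw [hDdiv, Polynomial.mem_degreeLE, ← Polynomial.natDegree_le_iff_degree_le,
    ← Polynomial.C_ofNat, Polynomial.natDegree_C_mul_X_pow _ _ two_ne_zero] at h
  omega
end

section
/- For every g ≥ 1, the linear map 𝔞_g(2) → Λ²H/ℚω̄₀ sending D to π(C₁₃(D*)) is surjective. -/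
/-- the contraction `C₁₃ : H^{⊗4} → H^{⊗2}`, `u₁⊗u₂⊗u₃⊗u₄ ↦ (u₁·u₃) u₂⊗u₄`. -/
def C13 (g : ℕ) (t : T g 4) : T g 2 := fun φ =>
  ∑ a : I g, ∑ b : I g,
    pairH g (Pi.single a 1) (Pi.single b 1) * t ![a, φ 0, b, φ 1]

/-- the wedge product `u ∧ v` as an element of the second exterior power `Λ²H`. -/
noncomputable def wedge (g : ℕ) (u v : H g) : ↥(⋀[ℚ]^2 (H g)) :=
  ⟨ExteriorAlgebra.ιMulti ℚ 2 ![u, v],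
    ExteriorAlgebra.ιMulti_range ℚ 2 (Set.mem_range_self _)⟩

/-- the canonical projection `H^{⊗2} → Λ²H`, `u⊗v ↦ u∧v`. -/
noncomputable def proj2 (g : ℕ) (t : T g 2) : ↥(⋀[ℚ]^2 (H g)) :=
  ∑ a : I g, ∑ b : I g,
    t ![a, b] • wedge g (Pi.single a 1) (Pi.single b 1)

/-- the symplectic class `ω̄₀ = Σᵢ xᵢ ∧ yᵢ ∈ Λ²H`. -/
noncomputable def omBar (g : ℕ) : ↥(⋀[ℚ]^2 (H g)) :=
  ∑ i : Fin g, wedge g (xB g i) (yB g i)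

/-- the quotient `Λ²H / ℚ ω̄₀`. -/
abbrev Lambda2Q (g : ℕ) := ↥(⋀[ℚ]^2 (H g)) ⧸ (Submodule.span ℚ {omBar g})

/-- the map `π : H^{⊗2} → Λ²H/ℚω̄₀`. -/
noncomputable def piQ (g : ℕ) (t : T g 2) : Lambda2Q g :=
  Submodule.Quotient.mk (proj2 g t)

/-- The linear map `H → H^{⊗(k+1)}` corresponding to a tensor in `H^{⊗(k+2)}` under `D ↦ D*`. -/
def dualHom (g k : ℕ) (t : T g (k + 2)) : H g →ₗ[ℚ] T g (k + 1) where
  toFun h := fun ψ => ∑ i : Fin g,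
    (h (Sum.inr i) * t (Fin.cons (Sum.inl i) ψ) - h (Sum.inl i) * t (Fin.cons (Sum.inr i) ψ))
  map_add' u v := by
    ext ψ
    simp only [Pi.add_apply, ← Finset.sum_add_distrib]
    exact Finset.sum_congr rfl fun i _ => by ring
  map_smul' c u := by
    ext ψ
    simp only [Pi.smul_apply, smul_eq_mul, RingHom.id_apply, Finset.mul_sum]
    exact Finset.sum_congr rfl fun i _ => by ring

lemma dualHom_xB (g k : ℕ) (t : T g (k + 2)) (i : Fin g) (ψ : Fin (k + 1) → I g) :
    dualHom g k t (xB g i) ψ = -t (Fin.cons (Sum.inr i) ψ) := by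
  simp [dualHom, xB, Pi.single_apply]

lemma dualHom_yB (g k : ℕ) (t : T g (k + 2)) (i : Fin g) (ψ : Fin (k + 1) → I g) :
    dualHom g k t (yB g i) ψ = t (Fin.cons (Sum.inl i) ψ) := by
  simp [dualHom, yB, Pi.single_apply]

lemma sum_xB_add_yB (g : ℕ) (a : I g) (f : I g → ℚ) :
    ∑ i : Fin g, (xB g i a * f (Sum.inl i) + yB g i a * f (Sum.inr i)) = f a := by
  rcases a with a | a <;> simp [xB, yB, Pi.single_apply]

lemma dstar_dualHom (g k : ℕ) (t : T g (k + 2)) : dstar g k (dualHom g k t) = t := by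
  ext φ
  simp only [dstar, dualHom_xB, dualHom_yB, mul_neg, sub_neg_eq_add]
  rw [sum_xB_add_yB g (φ 0) fun a => t (Fin.cons a fun p => φ p.succ)]
  exact congrArg t (Fin.cons_self_tail φ)

/-- `D` annihilates `ω₀` as soon as `D*` is invariant under cyclic permutations. -/
lemma Dom_dualHom (g k : ℕ) (t : T g (k + 2))
    (ht : ∀ φ : Fin (k + 2) → I g,
      t (Fin.cons (φ (Fin.last (k + 1))) fun p => φ p.castSucc) = t φ) :
    Dom g k (dualHom g k t) = 0 := by
  ext φ
  have h₁ := congrFun (dstar_dualHom g k t) φ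
  have h₂ := sum_xB_add_yB g (φ (Fin.last (k + 1))) fun a =>
    t (Fin.cons a fun p => φ p.castSucc)
  rw [ht φ, ← h₁, ← sub_eq_zero, dstar, ← Finset.sum_sub_distrib] at h₂
  rw [Pi.zero_apply, ← neg_eq_zero, ← h₂, Dom, ← Finset.sum_neg_distrib]
  refine Finset.sum_congr rfl fun i _ => ?_
  simp only [dualHom_xB, dualHom_yB]
  ring

/-- The matrix of the intersection pairing in the symplectic basis. -/
def pairMatrix (g : ℕ) (a b : I g) : ℚ := pairH g (Pi.single a 1) (Pi.single b 1)

lemma pairMatrix_swap (g : ℕ) (a b : I g) : pairMatrix g a b = -pairMatrix g b a := by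
  simp only [pairMatrix, pairH, ← Finset.sum_neg_distrib]
  exact Finset.sum_congr rfl fun i _ => by ring

@[simp] lemma pairMatrix_inl_inl (g : ℕ) (i j : Fin g) :
    pairMatrix g (Sum.inl i) (Sum.inl j) = 0 := by
  simp [pairMatrix, pairH, Pi.single_apply]

@[simp] lemma pairMatrix_inr_inr (g : ℕ) (i j : Fin g) :
    pairMatrix g (Sum.inr i) (Sum.inr j) = 0 := by
  simp [pairMatrix, pairH, Pi.single_apply]

@[simp] lemma pairMatrix_inl_inr (g : ℕ) (i j : Fin g) :
    pairMatrix g (Sum.inl i) (Sum.inr j) = if i = j then 1 else 0 := by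
  simp [pairMatrix, pairH, Pi.single_apply, eq_comm]

@[simp] lemma pairMatrix_inr_inl (g : ℕ) (i j : Fin g) :
    pairMatrix g (Sum.inr i) (Sum.inl j) = if i = j then -1 else 0 := by
  rw [pairMatrix_swap, pairMatrix_inl_inr]
  split_ifs <;> simp_all

lemma sum_pairMatrix_sq (g : ℕ) :
    ∑ a : I g, ∑ b : I g, pairMatrix g a b * pairMatrix g a b = 2 * g := by
  simp [two_mul]

lemma wedge_eq_ιMulti (g : ℕ) (u v : H g) : wedge g u v = exteriorPower.ιMulti ℚ 2 ![u, v] := rfl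

lemma wedge_swap (g : ℕ) (u v : H g) : wedge g u v = -wedge g v u := by
  have h := (exteriorPower.ιMulti ℚ 2 (M := H g)).map_swap ![v, u] (zero_ne_one (α := Fin 2))
  rw [wedge_eq_ιMulti, wedge_eq_ιMulti, ← h]
  congr 1
  ext i
  fin_cases i <;> simp

/-- `proj2` as a linear map. -/
noncomputable def proj2Hom (g : ℕ) : T g 2 →ₗ[ℚ] ↥(⋀[ℚ]^2 (H g)) where
  toFun := proj2 g
  map_add' s t := by simp only [proj2, Pi.add_apply, add_smul, Finset.sum_add_distrib]
  map_smul' c t := by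
    simp only [proj2, Pi.smul_apply, smul_eq_mul, mul_smul, Finset.smul_sum, RingHom.id_apply]

lemma proj2_single (g : ℕ) (a b : I g) :
    proj2 g (Pi.single ![a, b] 1) = wedge g (Pi.single a 1) (Pi.single b 1) := by
  rw [proj2, Finset.sum_eq_single a, Finset.sum_eq_single b]
  · simp
  · intro c _ hc
    rw [Pi.single_eq_of_ne, zero_smul]
    exact fun h => hc (congrFun h 1)
  · simp
  · intro c _ hc
    refine Finset.sum_eq_zero fun d _ => ?_
    rw [Pi.single_eq_of_ne, zero_smul]
    exact fun h => hc (congrFun h 0)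
  · simp

lemma proj2_surjective (g : ℕ) : Function.Surjective (proj2 g) := by
  have hs : Submodule.span ℚ (Set.range fun a : I g => (Pi.single a 1 : H g)) = ⊤ := by
    rw [← (Pi.basisFun ℚ (I g)).span_eq]
    congr 1
    ext
    simp
  have h : LinearMap.range (proj2Hom g) = ⊤ := by
    rw [eq_top_iff, ← exteriorPower.ιMulti_span_of_span ℚ 2 (H g) hs, Submodule.span_le]
    rintro _ ⟨m, hm, rfl⟩
    obtain ⟨a, ha⟩ := hm (Set.mem_range_self 0)
    obtain ⟨b, hb⟩ := hm (Set.mem_range_self 1)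
    refine ⟨Pi.single ![a, b] 1, (proj2_single g a b).trans ?_⟩
    rw [wedge_eq_ιMulti]
    congr 1
    ext i : 1
    fin_cases i
    exacts [ha, hb]
  exact LinearMap.range_eq_top.mp h

lemma proj2_swap (g : ℕ) (t : T g 2) : proj2 g (fun φ => t ![φ 1, φ 0]) = -proj2 g t := by
  simp only [proj2, ← Finset.sum_neg_distrib]
  rw [Finset.sum_comm]
  refine Finset.sum_congr rfl fun a _ => Finset.sum_congr rfl fun b _ => ?_
  rw [wedge_swap, smul_neg]
  rfl

lemma exists_antisymm_proj2_eq (g : ℕ) (w : ↥(⋀[ℚ]^2 (H g))) :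
    ∃ s : I g → I g → ℚ, (∀ a b, s a b = -s b a) ∧ proj2 g (fun φ => s (φ 0) (φ 1)) = w := by
  obtain ⟨t, rfl⟩ := proj2_surjective g w
  refine ⟨fun a b => (t ![a, b] - t ![b, a]) / 2, fun a b => by ring, ?_⟩
  have h : (fun φ : Fin 2 → I g => (t ![φ 0, φ 1] - t ![φ 1, φ 0]) / 2)
      = (1 / 2 : ℚ) • (t - fun φ => t ![φ 1, φ 0]) := by
    ext φ
    have hφ : ![φ 0, φ 1] = φ := by
      ext i : 1
      fin_cases i <;> rfl
    simp only [Pi.smul_apply, Pi.sub_apply, smul_eq_mul, hφ]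
    ring
  rw [h]
  change proj2Hom g _ = proj2Hom g t
  have h' : proj2Hom g (fun φ => t ![φ 1, φ 0]) = -proj2Hom g t := proj2_swap g t
  rw [map_smul, map_sub, h']
  module

lemma proj2_pairMatrix (g : ℕ) :
    proj2 g (fun φ => pairMatrix g (φ 0) (φ 1)) = (2 : ℚ) • omBar g := by
  simp only [proj2, omBar, Matrix.cons_val_zero, Matrix.cons_val_one, Fintype.sum_sum_type,
    pairMatrix_inl_inl, pairMatrix_inr_inr, pairMatrix_inl_inr, pairMatrix_inr_inl, zero_smul,
    ite_smul, Finset.sum_const_zero, Finset.sum_ite_eq, Finset.mem_univ, if_true, zero_add,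
    add_zero, one_smul, xB, yB]
  rw [two_smul]
  congr 1
  exact Finset.sum_congr rfl fun i _ => (wedge_swap g _ _).symm

/-- The sum of the cyclic rotations of `ω ⊗ s`, with `ω` inserted at the positions `1, 3`. -/
def cyclicTensor (g : ℕ) (s : I g → I g → ℚ) : T g 4 := fun φ =>
  pairMatrix g (φ 0) (φ 2) * s (φ 1) (φ 3) - pairMatrix g (φ 1) (φ 3) * s (φ 0) (φ 2)

lemma cyclicTensor_rotate (g : ℕ) (s : I g → I g → ℚ) (hs : ∀ a b, s a b = -s b a)
    (φ : Fin 4 → I g) :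
    cyclicTensor g s (Fin.cons (φ (Fin.last 3)) fun p => φ p.castSucc) = cyclicTensor g s φ := by
  change pairMatrix g (φ 3) (φ 1) * s (φ 0) (φ 2) - pairMatrix g (φ 0) (φ 2) * s (φ 3) (φ 1) =
    pairMatrix g (φ 0) (φ 2) * s (φ 1) (φ 3) - pairMatrix g (φ 1) (φ 3) * s (φ 0) (φ 2)
  rw [pairMatrix_swap g (φ 3), hs (φ 3)]
  ring

lemma C13_cyclicTensor (g : ℕ) (s : I g → I g → ℚ) :
    C13 g (cyclicTensor g s) = (2 * g : ℚ) • (fun φ => s (φ 0) (φ 1))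
      - (∑ a, ∑ b, pairMatrix g a b * s a b) • fun φ => pairMatrix g (φ 0) (φ 1) := by
  ext φ
  simp only [Pi.sub_apply, Pi.smul_apply, smul_eq_mul, ← sum_pairMatrix_sq, Finset.sum_mul,
    ← Finset.sum_sub_distrib]
  refine Finset.sum_congr rfl fun a _ => Finset.sum_congr rfl fun b _ => ?_
  change pairMatrix g a b *
    (pairMatrix g a b * s (φ 0) (φ 1) - pairMatrix g (φ 0) (φ 1) * s a b) = _
  ring

/-- for every `g ≥ 1`, the map `𝔞_g(2) → Λ²H/ℚω̄₀`, `D ↦ π(C₁₃(D*))`, is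
surjective. -/
theorem stmt8 (g : ℕ) (hg : 1 ≤ g) :
    ∀ z : Lambda2Q g, ∃ D : H g →ₗ[ℚ] T g 3,
      Dom g 2 D = 0 ∧ piQ g (C13 g (dstar g 2 D)) = z := by
  intro z
  obtain ⟨w, rfl⟩ := Submodule.Quotient.mk_surjective _ z
  obtain ⟨s, hs, hw⟩ := exists_antisymm_proj2_eq g ((2 * g : ℚ)⁻¹ • w)
  refine ⟨dualHom g 2 (cyclicTensor g s),
    Dom_dualHom g 2 _ (cyclicTensor_rotate g s hs), ?_⟩
  have hg' : (2 * g : ℚ) ≠ 0 := by positivity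
  rw [dstar_dualHom, C13_cyclicTensor, piQ, Submodule.Quotient.eq]
  change proj2Hom g _ - w ∈ _
  replace hw : proj2Hom g (fun φ => s (φ 0) (φ 1)) = (2 * g : ℚ)⁻¹ • w := hw
  have hω : proj2Hom g (fun φ => pairMatrix g (φ 0) (φ 1)) = (2 : ℚ) • omBar g :=
    proj2_pairMatrix g
  rw [map_sub, map_smul, map_smul, hw, hω, smul_inv_smul₀ hg', sub_sub_cancel_left, smul_smul]
  exact neg_mem (Submodule.smul_mem _ _ (Submodule.mem_span_singleton_self _))
end
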